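/- Let δ ∈ (0,1), let X ⊆ S be a homogeneous δ-solution of (VCP) with approximate upper image P_X := conv(F[X]) + C, let 0 < r < R_δ := √(1/δ² − 1), and let y ∈ bd P_X with ‖y‖ ≤ r. Then d(y, bd 𝒫) ≤ δ(r² + 1)/(√(1 − δ²) − δr). -/

import Mathlib

open Metric Set Pointwise

noncomputable section

/-- `ℝ^m` as a Euclidean space. -/
abbrev Em (m : ℕ) := EuclideanSpace ℝ (Fin m)

/-- `ℝ^(m+1)` realized as the L²-product `ℝ^m × ℝ`. -/
abbrev Em1 (m : ℕ) := WithLp 2 (Em m × ℝ)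

/-- The conic hull: all finite nonnegative combinations of elements of `M`. -/
def coneHull {V : Type*} [AddCommMonoid V] [Module ℝ V] (M : Set V) : Set V :=
  {x | ∃ (k : ℕ) (c : Fin k → ℝ) (v : Fin k → V),
    (∀ i, 0 ≤ c i) ∧ (∀ i, v i ∈ M) ∧ x = ∑ i, c i • v i}

/-- The vector `(y, 1) ∈ ℝ^(m+1)` obtained by appending a last coordinate `1` to `y`. -/
def lift1 {m : ℕ} (y : Em m) : Em1 m := (WithLp.equiv 2 (Em m × ℝ)).symm (y, 1)

/-- The homogenization `hom Z = cl (cone (Z × {1}))` of a set `Z ⊆ ℝ^m`. -/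
def homog {m : ℕ} (Z : Set (Em m)) : Set (Em1 m) := closure (coneHull (lift1 '' Z))

/-- The truncated Hausdorff distance `d_tH(K₁, K₂) = d_H(K₁ ∩ 𝔹, K₂ ∩ 𝔹)`. -/
def dtH {V : Type*} [NormedAddCommGroup V] (K₁ K₂ : Set V) : ℝ :=
  hausdorffDist (K₁ ∩ closedBall 0 1) (K₂ ∩ closedBall 0 1)

lemma aux_support {m : ℕ} (K : Set (Em m)) (hK : Convex ℝ K) (y : Em m) (hy : y ∈ frontier K) :
    ∃ w : Em m, ‖w‖ = 1 ∧ ∀ p ∈ K, inner ℝ w y ≤ inner ℝ w p := by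
  have hycl : y ∈ closure K := hy.1
  have hKne : K.Nonempty := closure_nonempty_iff.mp ⟨y, hycl⟩
  have key : ∃ f : Em m →L[ℝ] ℝ, f ≠ 0 ∧ ∀ p ∈ K, f y ≤ f p := by
    by_cases hi : (interior K).Nonempty
    · obtain ⟨f, hf⟩ := geometric_hahn_banach_open_point hK.interior isOpen_interior hy.2
      refine ⟨-f, ?_, ?_⟩
      · intro h
        obtain ⟨a, ha⟩ := hi
        have := hf a ha
        have h0 : f = 0 := by simpa using h
        simp [h0] at this
      · intro p hp
        have hp' : p ∈ closure (interior K) := by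
          rw [hK.closure_interior_eq_closure_of_nonempty_interior hi]
          exact subset_closure hp
        have : closure (interior K) ⊆ {x | f x ≤ f y} :=
          closure_minimal (fun a ha => (hf a ha).le) (isClosed_le f.continuous continuous_const)
        simpa using this hp'
    · rw [hK.interior_nonempty_iff_affineSpan_eq_top] at hi
      have hne : (affineSpan ℝ K : Set (Em m)).Nonempty := hKne.mono (subset_affineSpan ℝ K)
      have hd : (affineSpan ℝ K).direction ≠ ⊤ := fun h =>
        hi ((AffineSubspace.direction_eq_top_iff_of_nonempty hne).mp h)
      obtain ⟨φ, φne, hφ⟩ := Submodule.exists_dual_map_eq_bot_of_lt_top hd.lt_top inferInstance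
      refine ⟨LinearMap.toContinuousLinearMap φ, by simpa using φne, ?_⟩
      have hyA : y ∈ affineSpan ℝ K := by
        have : closure K ⊆ (affineSpan ℝ K : Set (Em m)) :=
          closure_minimal (subset_affineSpan ℝ K) (AffineSubspace.closed_of_finiteDimensional _)
        exact this hycl
      intro p hp
      have h1 : p - y ∈ (affineSpan ℝ K).direction :=
        AffineSubspace.vsub_mem_direction (subset_affineSpan ℝ K hp) hyA
      have h2 : φ (p - y) = 0 := by
        have : φ (p - y) ∈ (affineSpan ℝ K).direction.map φ := Submodule.mem_map_of_mem h1
        rw [hφ] at this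
        simpa using this
      rw [map_sub] at h2
      simp only [LinearMap.coe_toContinuousLinearMap']
      linarith
  obtain ⟨f, hf0, hf⟩ := key
  set v := (InnerProductSpace.toDual ℝ (Em m)).symm f with hv
  have hvf : ∀ x, inner ℝ v x = f x := fun x => InnerProductSpace.toDual_symm_apply
  have hv0 : v ≠ 0 := by simpa [hv] using hf0
  have hn : 0 < ‖v‖ := norm_pos_iff.mpr hv0
  refine ⟨‖v‖⁻¹ • v, by rw [norm_smul]; simp [hn.ne'], ?_⟩
  intro p hp
  simp only [real_inner_smul_left, hvf]
  exact mul_le_mul_of_nonneg_left (hf p hp) (by positivity)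

lemma aux_algebra (δ r s γ N : ℝ) (hδ : δ ∈ Set.Ioo (0:ℝ) 1) (hr0 : 0 < r)
    (hpos : 0 < Real.sqrt (1 - δ ^ 2) - δ * r) (hs : 0 < s) (hN0 : 0 ≤ N) (hN : N ≤ r)
    (hγ : |γ| ≤ r) (h : s ^ 2 ≤ δ ^ 2 * ((1 + γ ^ 2) * (1 + (N ^ 2 - 2 * s * γ + s ^ 2)))) :
    s ≤ δ * (r ^ 2 + 1) / (Real.sqrt (1 - δ ^ 2) - δ * r) := by
  obtain ⟨h0, h1⟩ := hδ
  have hq : Real.sqrt (1 - δ ^ 2) ^ 2 = 1 - δ ^ 2 := Real.sq_sqrt (by nlinarith)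
  have hq0 := Real.sqrt_nonneg (1 - δ ^ 2)
  set q := Real.sqrt (1 - δ ^ 2)
  obtain ⟨hg1, hg2⟩ := abs_le.mp hγ
  have e1 : γ ^ 2 ≤ r ^ 2 := by nlinarith
  have e2 : N ^ 2 ≤ r ^ 2 := by nlinarith
  have e3 : 1 + (N ^ 2 - 2 * s * γ + s ^ 2) ≤ 1 + (r ^ 2 + 2 * s * r + s ^ 2) := by nlinarith
  have e4 : (1 + γ ^ 2) * (1 + (N ^ 2 - 2 * s * γ + s ^ 2)) ≤
      (1 + r ^ 2) * (1 + (r ^ 2 + 2 * s * r + s ^ 2)) :=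
    (mul_le_mul_of_nonneg_left e3 (by positivity)).trans
      (mul_le_mul_of_nonneg_right (by linarith) (by positivity))
  have e5 := h.trans (mul_le_mul_of_nonneg_left e4 (sq_nonneg δ))
  rw [le_div_iff₀ hpos]
  by_contra! hc
  have h2 : 0 < (q + δ * r) * s + δ * (r ^ 2 + 1) := by positivity
  have h3 : 0 < (s * (q - δ * r) - δ * (r ^ 2 + 1)) * ((q + δ * r) * s + δ * (r ^ 2 + 1)) :=
    mul_pos (by linarith) h2
  have h4 : (s * (q - δ * r) - δ * (r ^ 2 + 1)) * ((q + δ * r) * s + δ * (r ^ 2 + 1)) =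
     (q ^ 2 - δ ^ 2 * r ^ 2) * s ^ 2 - 2 * δ ^ 2 * (r ^ 2 + 1) * r * s
       - δ ^ 2 * (r ^ 2 + 1) ^ 2 := by ring
  rw [h4, hq] at h3
  linarith

lemma aux_zero {m : ℕ} (Z : Set (Em m)) : (0 : Em1 m) ∈ homog Z ∩ closedBall 0 1 := by
  refine ⟨subset_closure ⟨0, fun _ => 0, fun _ => 0, ?_, ?_, ?_⟩, by simp⟩
  · intro i; exact i.elim0
  · intro i; exact i.elim0
  · simp

lemma aux_conv {n m : ℕ} (S : Set (Em n)) (hSconv : Convex ℝ S)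
    (C : Set (Em m)) (hC0 : (0 : Em m) ∈ C)
    (hadd : ∀ a ∈ C, ∀ b ∈ C, a + b ∈ C)
    (hCcone : ∀ c ∈ C, ∀ r : ℝ, 0 ≤ r → r • c ∈ C)
    (F : Em n → Em m)
    (hFconv : ∀ x₁ x₂ : Em n, ∀ l : ℝ, l ∈ Set.Ioo (0:ℝ) 1 →
      l • F x₁ + (1 - l) • F x₂ - F (l • x₁ + (1 - l) • x₂) ∈ C) :
    Convex ℝ (F '' S + C) := by
  rw [convex_iff_forall_pos]
  rintro _ ⟨_, ⟨x₁, h₁, rfl⟩, c₁, hc₁, rfl⟩ _ ⟨_, ⟨x₂, h₂, rfl⟩, c₂, hc₂, rfl⟩ a b ha hb hab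
  obtain rfl : b = 1 - a := by linarith
  refine ⟨F (a • x₁ + (1 - a) • x₂), ⟨_, hSconv h₁ h₂ ha.le hb.le hab, rfl⟩,
    (a • F x₁ + (1 - a) • F x₂ - F (a • x₁ + (1 - a) • x₂)) + (a • c₁ + (1 - a) • c₂), ?_, ?_⟩
  · exact hadd _ (hFconv _ _ _ ⟨ha, by linarith⟩) _
      (hadd _ (hCcone _ hc₁ _ ha.le) _ (hCcone _ hc₂ _ hb.le))
  · simp only [smul_add]
    abel

lemma aux_ball {m : ℕ} (P : Set (Em m)) (hP : IsClosed P) (y : Em m) (hy : y ∈ P)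
    (hs : 0 < infDist y (frontier P)) : closedBall y (infDist y (frontier P)) ⊆ P := by
  set s := infDist y (frontier P)
  have hd : Disjoint (ball y s) (frontier P) := disjoint_ball_infDist
  rw [← closure_ball y hs.ne']
  refine closure_minimal ?_ hP
  have hcon : IsPreconnected (ball y s) := (convex_ball y s).isPreconnected
  have hcov : ball y s ⊆ interior P ∪ Pᶜ := by
    intro z hz
    by_cases hzP : z ∈ P
    · left
      by_contra hi
      exact Set.disjoint_left.mp hd hz ⟨subset_closure hzP, hi⟩
    · right; exact hzP
  have := hcon.subset_or_subset isOpen_interior hP.isOpen_compl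
    (Set.disjoint_left.mpr fun z hz hz' => hz' (interior_subset hz)) hcov
  rcases this with h | h
  · exact h.trans interior_subset
  · exact absurd hy (h (mem_ball_self hs))

/-- Let `X ⊆ S` be a homogeneous `δ`-solution of (VCP) with approximate upper image
`P_X = conv F[X] + C`, let `0 < r < R_δ = √(1/δ² − 1)`, and let `y ∈ bd P_X` with
`‖y‖ ≤ r`.  Then `d(y, bd 𝒫) ≤ δ(r² + 1)/(√(1 − δ²) − δr)`. -/
theorem error_bound_in_region_of_interest
    {n m : ℕ} (S : Set (Em n)) (hSne : S.Nonempty) (hSconv : Convex ℝ S)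
    (C : Set (Em m)) (hC0 : (0 : Em m) ∈ C)
    (hCcone : ∀ c ∈ C, ∀ r : ℝ, 0 ≤ r → r • c ∈ C)
    (hCconv : Convex ℝ C) (hCclosed : IsClosed C)
    (hCpointed : C ∩ (-C) ⊆ {0}) (hCnontrivial : C ≠ {0})
    (F : Em n → Em m)
    (hFconv : ∀ x₁ x₂ : Em n, ∀ l : ℝ, l ∈ Set.Ioo (0:ℝ) 1 →
      l • F x₁ + (1 - l) • F x₂ - F (l • x₁ + (1 - l) • x₂) ∈ C)
    (δ : ℝ) (hδ : δ ∈ Set.Ioo (0:ℝ) 1)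
    (X : Set (Em n)) (hXne : X.Nonempty) (hXS : X ⊆ S)
    (hXsol : dtH (homog (convexHull ℝ (F '' X) + C)) (homog (closure (F '' S + C))) ≤ δ)
    (r : ℝ) (hr0 : 0 < r) (hrR : r < Real.sqrt (1 / δ ^ 2 - 1))
    (y : Em m) (hy : y ∈ frontier (convexHull ℝ (F '' X) + C)) (hyr : ‖y‖ ≤ r) :
    infDist y (frontier (closure (F '' S + C))) ≤
      δ * (r ^ 2 + 1) / (Real.sqrt (1 - δ ^ 2) - δ * r) := by
  obtain ⟨h0, h1⟩ := hδ
  have hadd : ∀ a ∈ C, ∀ b ∈ C, a + b ∈ C := by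
    intro a ha b hb
    have := hCcone _ (hCconv ha hb (a := 1/2) (b := 1/2) (by norm_num) (by norm_num)
      (by norm_num)) 2 (by norm_num)
    rw [← smul_add, smul_smul] at this
    simpa using this
  have hconv := aux_conv S hSconv C hC0 hadd hCcone F hFconv
  have hpos : 0 < Real.sqrt (1 - δ ^ 2) - δ * r := by
    have e : δ * Real.sqrt (1 / δ ^ 2 - 1) = Real.sqrt (1 - δ ^ 2) := by
      rw [← Real.sqrt_sq h0.le, ← Real.sqrt_mul (sq_nonneg _), Real.sqrt_sq h0.le]
      congr 1
      field_simp
    have := mul_lt_mul_of_pos_left hrR h0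
    linarith
  set K := convexHull ℝ (F '' X) + C with hK
  set P := closure (F '' S + C) with hPdef
  have hKP : K ⊆ F '' S + C := by
    have hsub : convexHull ℝ (F '' X) ⊆ F '' S + C := by
      refine convexHull_min ?_ hconv
      rintro _ ⟨x, hx, rfl⟩
      exact ⟨F x, ⟨x, hXS hx, rfl⟩, 0, hC0, by simp⟩
    rintro _ ⟨a, ha, c, hc, rfl⟩
    obtain ⟨f, hf, d, hd, rfl⟩ := hsub ha
    exact ⟨f, hf, d + c, hadd _ hd _ hc, by simp [add_assoc]⟩
  have hyP : y ∈ P := closure_mono hKP hy.1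
  by_cases hs : 0 < infDist y (frontier P)
  swap
  · refine (not_lt.mp hs).trans ?_
    positivity
  have hball := aux_ball P isClosed_closure y hyP hs
  set s := infDist y (frontier P) with hsdef
  obtain ⟨w, hw, hwK⟩ := aux_support K ((convex_convexHull ℝ _).add hCconv) y hy
  set γ := inner ℝ w y with hγdef
  have hγ : |γ| ≤ r := by
    have := abs_real_inner_le_norm w y
    rw [hw, one_mul] at this
    exact this.trans hyr
  set p := y - s • w with hp
  have hpP : p ∈ P := by
    apply hball
    rw [mem_closedBall, dist_eq_norm, hp]
    simp [norm_smul, hw, abs_of_pos hs]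
  have hpn : ‖p‖ ^ 2 = ‖y‖ ^ 2 - 2 * s * γ + s ^ 2 := by
    rw [hp, norm_sub_sq_real, inner_smul_right, real_inner_comm, norm_smul, hw]
    simp only [Real.norm_eq_abs, mul_one, sq_abs]
    ring
  have hwp : inner ℝ w p = γ - s := by
    rw [hp, inner_sub_right, inner_smul_right, real_inner_self_eq_norm_sq, hw]
    simp [hγdef]
  refine aux_algebra δ r s γ ‖y‖ ⟨h0, h1⟩ hr0 hpos hs (norm_nonneg _) hyr hγ ?_
  rw [← hpn]
  -- the normal vector of the homogenized supporting half-space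
  set W : Em1 m := WithLp.toLp 2 (w, -γ) with hW
  have hWn : ‖W‖ ^ 2 = 1 + γ ^ 2 := by
    rw [WithLp.prod_norm_sq_eq_of_L2]
    simp [hW, hw]
  have hWl : ∀ z : Em m, inner ℝ W (lift1 z) = inner ℝ w z - γ := by
    intro z
    rw [WithLp.prod_inner_apply]
    simp [hW, lift1]
    ring
  have hln : ‖(lift1 p : Em1 m)‖ ^ 2 = 1 + ‖p‖ ^ 2 := by
    rw [WithLp.prod_norm_sq_eq_of_L2]
    simp [lift1]
    ring
  have hhalf : ∀ h ∈ homog K, 0 ≤ inner ℝ W h := by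
    have : homog K ⊆ {h | 0 ≤ inner ℝ W h} := by
      refine closure_minimal ?_ (isClosed_le continuous_const (by fun_prop))
      rintro _ ⟨k, c, v, hc, hv, rfl⟩
      simp only [Set.mem_ofPred_eq, inner_sum, inner_smul_right]
      refine Finset.sum_nonneg fun i _ => mul_nonneg (hc i) ?_
      obtain ⟨z, hz, hzv⟩ := hv i
      rw [← hzv, hWl]
      linarith [hwK z hz]
    exact this
  set N := ‖(lift1 p : Em1 m)‖ with hN
  have hNpos : 0 < N := by
    have : 0 < N ^ 2 := by rw [hln]; positivity
    exact lt_of_le_of_ne (norm_nonneg _) (fun h => this.ne (by rw [← h]; simp))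
  set Q : Em1 m := N⁻¹ • lift1 p with hQ
  have hQmem : Q ∈ homog P ∩ closedBall 0 1 := by
    refine ⟨subset_closure ⟨1, fun _ => N⁻¹, fun _ => lift1 p, ?_, ?_, ?_⟩, ?_⟩
    · intro _; positivity
    · intro _; exact ⟨p, hpP, rfl⟩
    · simp [hQ]
    · rw [mem_closedBall_zero_iff, hQ, norm_smul, ← hN]
      rw [Real.norm_of_nonneg (by positivity), inv_mul_cancel₀ hNpos.ne']
  have hbd : ∀ Z : Set (Em m), Bornology.IsBounded (homog Z ∩ closedBall 0 1) := fun Z =>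
    isBounded_closedBall.subset inter_subset_right
  have hfin : hausdorffEDist (homog P ∩ closedBall 0 1) (homog K ∩ closedBall 0 1) ≠ ⊤ :=
    hausdorffEDist_ne_top_of_nonempty_of_bounded ⟨_, aux_zero P⟩ ⟨_, aux_zero K⟩ (hbd P) (hbd K)
  have hle : infDist Q (homog K ∩ closedBall 0 1) ≤ δ := by
    refine (infDist_le_hausdorffDist_of_mem hQmem hfin).trans ?_
    rw [hausdorffDist_comm]
    exact hXsol
  have hWpos : 0 < ‖W‖ := by
    have : ‖W‖ ^ 2 ≠ 0 := by rw [hWn]; positivity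
    exact lt_of_le_of_ne (norm_nonneg _) (fun h => this (by rw [← h]; simp))
  have hlow : s / N / ‖W‖ ≤ infDist Q (homog K ∩ closedBall 0 1) := by
    refine (le_infDist ⟨_, aux_zero K⟩).mpr ?_
    intro h hh
    rw [div_le_iff₀ hWpos, dist_comm, dist_eq_norm]
    have e1 : inner ℝ W (h - Q) ≤ ‖W‖ * ‖h - Q‖ := real_inner_le_norm _ _
    have e2 : inner ℝ W Q = -(s / N) := by
      rw [hQ, inner_smul_right, hWl, hwp]
      field_simp
      ring
    rw [inner_sub_right, e2] at e1
    have := hhalf h hh.1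
    linarith
  have hfinal := hlow.trans hle
  rw [div_le_iff₀ hWpos, div_le_iff₀ hNpos] at hfinal
  rw [← hWn, ← hln]
  calc s ^ 2 ≤ (δ * ‖W‖ * N) ^ 2 := pow_le_pow_left₀ hs.le hfinal 2
    _ = _ := by ring
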